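/- Let n, k be positive integers and u, w, x, z ∈ S_∞ with u ≤_k w and x ≤_k z. Suppose w∘u^{-1} and z∘x^{-1} both lie in S_n and z∘x^{-1} = σ∘(w∘u^{-1})∘σ^{-1}, where σ ∈ S_n is the n-cycle with σ(i) = i+1 for 1 ≤ i < n and σ(n) = 1. Then the number of saturated chains in the k-Bruhat order from u to w equals the number of saturated chains in the k-Bruhat order from x to z. -/

import Mathlib

/-- `S_∞`: a permutation of the positive integers lies in `S_∞` iff it
fixes all but finitely many integers. -/
def finSupp (w : Equiv.Perm ℕ+) : Prop := {i : ℕ+ | w i ≠ i}.Finite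

/-- The length `ℓ(w) = #{(i,j) : i < j and w(i) > w(j)}`. -/
noncomputable def len (w : Equiv.Perm ℕ+) : ℕ :=
  {p : ℕ+ × ℕ+ | p.1 < p.2 ∧ w p.2 < w p.1}.ncard

/-- Cover relation of the `k`-Bruhat order: `w = u∘(a,b)` with `a ≤ k < b`
and `ℓ(w) = ℓ(u) + 1`. -/
def kBruhatCover (k : ℕ) (u w : Equiv.Perm ℕ+) : Prop :=
  ∃ a b : ℕ+, (a : ℕ) ≤ k ∧ k < (b : ℕ) ∧ w = u * Equiv.swap a b ∧ len w = len u + 1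

/-- The `k`-Bruhat order `≤_k`: reflexive–transitive closure of the cover relation. -/
def kBruhatLE (k : ℕ) : Equiv.Perm ℕ+ → Equiv.Perm ℕ+ → Prop :=
  Relation.ReflTransGen (kBruhatCover k)

/-- Saturated chains in the `k`-Bruhat order from `u` to `w`, as lists of
permutations each covering the previous one. -/
def chainsSet (k : ℕ) (u w : Equiv.Perm ℕ+) : Set (List (Equiv.Perm ℕ+)) :=
  {c | List.Chain' (kBruhatCover k) c ∧ c.head? = some u ∧ c.getLast? = some w}

section

open Equiv
/-- Strict cyclic order on a linearly ordered set. -/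
def CycLT {α : Type*} [LinearOrder α] (x y z : α) : Prop :=
  (x < y ∧ y < z) ∨ (y < z ∧ z < x) ∨ (z < x ∧ x < y)

/-- The cover relation of bounded affine permutations, read on residues: exchanging the values of
`π` at `i` and `j` uncrosses the chords `i → π i` and `j → π j`. -/
def CycCover {α : Type*} [LinearOrder α] (π : Perm α) (i j : α) : Prop :=
  i ≠ j ∧ (j = π i ∨ CycLT i j (π i)) ∧ (π j = i ∨ CycLT (π i) (π j) i) ∧
    ∀ c, CycLT i c j → ¬ CycLT (π i) (π c) (π j)

/-- Two successive covers. -/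
def CycPath {α : Type*} [LinearOrder α] (π : Perm α) (i j p q : α) : Prop :=
  CycCover π i j ∧ CycCover (π * swap i j) p q

variable {α : Type*} [LinearOrder α]

lemma mul_swap_apply_eq_ite (π : Perm α) (i j x : α) :
    (π * swap i j) x = if x = i then π j else if x = j then π i else π x := by
  simp only [Perm.mul_apply, swap_apply_def]; split_ifs <;> rfl

lemma eq_or_lt_or_gt_and_apply (π : Perm α) (x y : α) :
    x = y ∨ (x < y ∨ y < x) ∧ (π x < π y ∨ π y < π x) :=
  or_iff_not_imp_left.2 fun h => ⟨lt_or_gt_of_ne h, lt_or_gt_of_ne (π.injective.ne h)⟩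

lemma CycPath.pointwise {π : Perm α} {i j p q : α} (h : CycPath π i j p q) (x : α) :
    (CycLT i x j → ¬ CycLT (π i) (π x) (π j)) ∧ (CycLT p x q →
      ¬ CycLT ((π * swap i j) p) ((π * swap i j) x) ((π * swap i j) q)) :=
  ⟨h.1.2.2.2 x, h.2.2.2.2 x⟩

lemma CycCover.of_pointwise {π : Perm α} {i j : α} (hij : i ≠ j)
    (h : ∀ x, ((j = π i ∨ CycLT i j (π i)) ∧ (π j = i ∨ CycLT (π i) (π j) i)) ∧
      (CycLT i x j → ¬ CycLT (π i) (π x) (π j))) : CycCover π i j :=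
  ⟨hij, (h i).1.1, (h i).1.2, fun x => (h x).2⟩

lemma path_left_ascent (π : Perm α) {a b c : α} (hab : a ≠ b) (hbc : b ≠ c) (hac : a ≠ c) :
    CycPath π a b b c ∧ CycLT (π a) (π b) (π c) ↔ CycPath π b c a c ∧ CycLT a b c := by
  constructor <;> rintro ⟨h, h0⟩
  all_goals
    have key (x) := And.intro (h.pointwise x) (And.intro (eq_or_lt_or_gt_and_apply π x a)
      (And.intro (eq_or_lt_or_gt_and_apply π x b) (eq_or_lt_or_gt_and_apply π x c)))
    have ka := key a
    have kb := key b
    have kc := key c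
    obtain ⟨⟨-, a2, a3, -⟩, -, b2, b3, -⟩ := h
    refine ⟨⟨.of_pointwise ‹_› fun x => ?_, .of_pointwise ‹_› fun x => ?_⟩, ?_⟩
    on_goal 3 => specialize key a
    all_goals
      first | specialize key x | skip
      simp only [CycLT, mul_swap_apply_eq_ite, hab, hbc, hac, hab.symm, hbc.symm, hac.symm,
        if_true, if_false] at *
      grind (splits := 40)

lemma path_left_descent (π : Perm α) {a b c : α} (hab : a ≠ b) (hbc : b ≠ c) (hac : a ≠ c) :
    CycPath π a b b c ∧ ¬ CycLT (π a) (π b) (π c) ↔ CycPath π a c a b ∧ CycLT a b c := by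
  constructor <;> rintro ⟨h, h0⟩
  all_goals
    have key (x) := And.intro (h.pointwise x) (And.intro (eq_or_lt_or_gt_and_apply π x a)
      (And.intro (eq_or_lt_or_gt_and_apply π x b) (eq_or_lt_or_gt_and_apply π x c)))
    have ka := key a
    have kb := key b
    have kc := key c
    obtain ⟨⟨-, a2, a3, -⟩, -, b2, b3, -⟩ := h
    refine ⟨⟨.of_pointwise ‹_› fun x => ?_, .of_pointwise ‹_› fun x => ?_⟩, ?_⟩
    on_goal 3 => specialize key a
    all_goals
      first | specialize key x | skip
      simp only [CycLT, mul_swap_apply_eq_ite, hab, hbc, hac, hab.symm, hbc.symm, hac.symm,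
        if_true, if_false] at *
      grind (splits := 40)

lemma path_right_ascent (π : Perm α) {a b c : α} (hab : a ≠ b) (hbc : b ≠ c) (hac : a ≠ c) :
    CycPath π b c a b ∧ CycLT (π a) (π b) (π c) ↔ CycPath π a b a c ∧ CycLT a b c := by
  constructor <;> rintro ⟨h, h0⟩
  all_goals
    have key (x) := And.intro (h.pointwise x) (And.intro (eq_or_lt_or_gt_and_apply π x a)
      (And.intro (eq_or_lt_or_gt_and_apply π x b) (eq_or_lt_or_gt_and_apply π x c)))
    have ka := key a
    have kb := key b
    have kc := key c
    obtain ⟨⟨-, a2, a3, -⟩, -, b2, b3, -⟩ := h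
    refine ⟨⟨.of_pointwise ‹_› fun x => ?_, .of_pointwise ‹_› fun x => ?_⟩, ?_⟩
    on_goal 3 => specialize key a
    all_goals
      first | specialize key x | skip
      simp only [CycLT, mul_swap_apply_eq_ite, hab, hbc, hac, hab.symm, hbc.symm, hac.symm,
        if_true, if_false] at *
      grind (splits := 40)

lemma path_right_descent (π : Perm α) {a b c : α} (hab : a ≠ b) (hbc : b ≠ c) (hac : a ≠ c) :
    CycPath π b c a b ∧ ¬ CycLT (π a) (π b) (π c) ↔ CycPath π a c b c ∧ CycLT a b c := by
  constructor <;> rintro ⟨h, h0⟩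
  all_goals
    have key (x) := And.intro (h.pointwise x) (And.intro (eq_or_lt_or_gt_and_apply π x a)
      (And.intro (eq_or_lt_or_gt_and_apply π x b) (eq_or_lt_or_gt_and_apply π x c)))
    have ka := key a
    have kb := key b
    have kc := key c
    obtain ⟨⟨-, a2, a3, -⟩, -, b2, b3, -⟩ := h
    refine ⟨⟨.of_pointwise ‹_› fun x => ?_, .of_pointwise ‹_› fun x => ?_⟩, ?_⟩
    on_goal 3 => specialize key a
    all_goals
      first | specialize key x | skip
      simp only [CycLT, mul_swap_apply_eq_ite, hab, hbc, hac, hab.symm, hbc.symm, hac.symm,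
        if_true, if_false] at *
      grind (splits := 40)

lemma CycPath.swap_of_disjoint {π : Perm α} {i j p q : α} (h : CycPath π i j p q)
    (hip : i ≠ p) (hiq : i ≠ q) (hjp : j ≠ p) (hjq : j ≠ q) : CycPath π p q i j := by
  have hij := h.1.1
  have hpq := h.2.1
  have key (x) := And.intro (h.pointwise x) (And.intro (eq_or_lt_or_gt_and_apply π x i)
      (And.intro (eq_or_lt_or_gt_and_apply π x j) (And.intro (eq_or_lt_or_gt_and_apply π x p)
      (eq_or_lt_or_gt_and_apply π x q))))
  have ki := key i
  have kj := key j
  have kp := key p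
  have kq := key q
  obtain ⟨⟨-, a2, a3, -⟩, -, b2, b3, -⟩ := h
  refine ⟨.of_pointwise ‹_› fun x => ?_, .of_pointwise ‹_› fun x => ?_⟩
  all_goals
    specialize key x
    simp only [CycLT, mul_swap_apply_eq_ite, hij, hpq, hip, hiq, hjp, hjq, hij.symm, hpq.symm,
      hip.symm, hiq.symm, hjp.symm, hjq.symm, if_true, if_false] at *
    grind (splits := 60)

lemma not_cycPath_self (π : Perm α) (i j : α) : ¬ CycPath π i j i j := by
  rintro ⟨⟨h, a2, a3, -⟩, -, b2, b3, -⟩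
  have := eq_or_lt_or_gt_and_apply π i j
  simp only [CycLT, mul_swap_apply_eq_ite, h, h.symm, if_true, if_false] at *
  grind

lemma not_cycPath_symm (π : Perm α) (i j : α) : ¬ CycPath π i j j i := by
  rintro ⟨⟨h, a2, a3, -⟩, -, b2, b3, -⟩
  have := eq_or_lt_or_gt_and_apply π i j
  simp only [CycLT, mul_swap_apply_eq_ite, h, h.symm, if_true, if_false] at *
  grind

open Classical in
/-- The other path of length two with the same end points. -/
noncomputable def flipPath (π : Perm α) : (α × α) × (α × α) → (α × α) × (α × α)
  | ((i, j), (p, q)) =>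
    if j = p then if CycLT (π i) (π j) (π q) then ((j, q), (i, q)) else ((i, q), (i, j))
    else if i = q then if CycLT (π p) (π i) (π j) then ((p, i), (p, j)) else ((p, j), (i, j))
    else if i = p then if CycLT i j q then ((j, q), (i, j)) else ((i, q), (q, j))
    else if j = q then if CycLT p i j then ((p, i), (i, j)) else ((p, j), (i, p))
    else ((p, q), (i, j))

/-- A function on pairs that is additive along cyclically ordered triples. -/
def IsCycCocycle (w : α → α → ℤ) : Prop := ∀ a b c, CycLT a b c → w a b + w b c = w a c

/-- `r` and `s` are two different paths from `π` with the same end point, with opposite values of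
every alternating combination of cocycles. -/
structure IsFlip (π : Perm α) (r s : (α × α) × (α × α)) : Prop where
  path : CycPath π s.1.1 s.1.2 s.2.1 s.2.2
  flip_eq : flipPath π s = r
  ne : s ≠ r
  target : swap s.1.1 s.1.2 * swap s.2.1 s.2.2 = swap r.1.1 r.1.2 * swap r.2.1 r.2.2
  mem : ∀ S : Finset α, r.1.1 ∈ S → r.1.2 ∈ S → r.2.1 ∈ S → r.2.2 ∈ S →
    s.1.1 ∈ S ∧ s.1.2 ∈ S ∧ s.2.1 ∈ S ∧ s.2.2 ∈ S
  alternating : ∀ w x : α → α → ℤ, IsCycCocycle w → IsCycCocycle x →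
    w s.1.1 s.1.2 * x s.2.1 s.2.2 - x s.1.1 s.1.2 * w s.2.1 s.2.2 =
      -(w r.1.1 r.1.2 * x r.2.1 r.2.2 - x r.1.1 r.1.2 * w r.2.1 r.2.2)

lemma swap_mul_swap_rotate {a b c : α} (hab : a ≠ b) (hbc : b ≠ c) (hac : a ≠ c) :
    swap a b * swap b c = swap b c * swap a c ∧ swap a b * swap b c = swap a c * swap a b ∧
    swap b c * swap a b = swap a b * swap a c ∧ swap b c * swap a b = swap a c * swap b c := by
  refine ⟨?_, ?_, ?_, ?_⟩ <;>
  · ext x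
    simp only [Perm.mul_apply, swap_apply_def]
    grind

lemma cycLT_of_not {a b c : α} (h : ¬ CycLT a b c) (hab : a ≠ b) (hbc : b ≠ c) (hac : a ≠ c) :
    CycLT a c b := by
  unfold CycLT at *
  grind

lemma CycLT.not {a b c : α} (h : CycLT a b c) : ¬ CycLT a c b := by
  unfold CycLT at *
  grind

lemma CycLT.not' {a b c : α} (h : CycLT a b c) : ¬ CycLT b a c := by
  unfold CycLT at *
  grind

lemma CycPath.isFlip {π : Perm α} {r : (α × α) × (α × α)}
    (h : CycPath π r.1.1 r.1.2 r.2.1 r.2.2) : IsFlip π r (flipPath π r) := by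
  obtain ⟨⟨i, j⟩, p, q⟩ := r
  have hij : i ≠ j := h.1.1
  have hpq : p ≠ q := h.2.1
  dsimp only at h
  by_cases hjp : j = p
  · subst hjp
    have hiq : i ≠ q := by rintro rfl; exact not_cycPath_symm π _ _ h
    obtain ⟨e1, e2, -, -⟩ := swap_mul_swap_rotate hij hpq hiq
    by_cases hv : CycLT (π i) (π j) (π q)
    · obtain ⟨h', hc⟩ := (path_left_ascent π hij hpq hiq).1 ⟨h, hv⟩
      have e : flipPath π ((i, j), (j, q)) = ((j, q), (i, q)) := by simp [flipPath, hv]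
      rw [e]
      refine ⟨h', ?_, ?_, e1.symm, by grind, fun w x hw hx => ?_⟩
      · simp [flipPath, hiq.symm, hij.symm, hpq, hc]
      · simp [hij.symm]
      · have := hw _ _ _ hc
        have := hx _ _ _ hc
        grind
    · obtain ⟨h', hc⟩ := (path_left_descent π hij hpq hiq).1 ⟨h, hv⟩
      have e : flipPath π ((i, j), (j, q)) = ((i, q), (i, j)) := by simp [flipPath, hv]
      rw [e]
      refine ⟨h', ?_, ?_, e2.symm, by grind, fun w x hw hx => ?_⟩
      · simp [flipPath, hiq.symm, hij, hc.not]
      · simp [hpq.symm]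
      · have := hw _ _ _ hc
        have := hx _ _ _ hc
        grind
  by_cases hiq : i = q
  · subst hiq
    have hpj : p ≠ j := Ne.symm hjp
    obtain ⟨-, -, e1, e2⟩ := swap_mul_swap_rotate hpq hij hpj
    by_cases hv : CycLT (π p) (π i) (π j)
    · obtain ⟨h', hc⟩ := (path_right_ascent π hpq hij hpj).1 ⟨h, hv⟩
      have e : flipPath π ((i, j), (p, i)) = ((p, i), (p, j)) := by simp [flipPath, hv, hjp]
      rw [e]
      refine ⟨h', ?_, ?_, e1.symm, by grind, fun w x hw hx => ?_⟩
      · simp [flipPath, hpq.symm, hpj, hc]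
      · simp [hpq]
      · have := hw _ _ _ hc
        have := hx _ _ _ hc
        grind
    · obtain ⟨h', hc⟩ := (path_right_descent π hpq hij hpj).1 ⟨h, hv⟩
      have e : flipPath π ((i, j), (p, i)) = ((p, j), (i, j)) := by simp [flipPath, hv, hjp]
      rw [e]
      refine ⟨h', ?_, ?_, e2.symm, by grind, fun w x hw hx => ?_⟩
      · simp [flipPath, hij.symm, hpj, hpq, hc.not']
      · simp [hpq]
      · have := hw _ _ _ hc
        have := hx _ _ _ hc
        grind
  by_cases hip : i = p
  · subst hip
    have hjq : j ≠ q := by rintro rfl; exact not_cycPath_self π _ _ h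
    by_cases hc : CycLT i j q
    · obtain ⟨h', hv⟩ := (path_right_ascent π hij hjq hpq).2 ⟨h, hc⟩
      have e : flipPath π ((i, j), (i, q)) = ((j, q), (i, j)) := by
        simp [flipPath, hc, hjp, hiq]
      rw [e]
      refine ⟨h', ?_, ?_, (swap_mul_swap_rotate hij hjq hpq).2.2.1, by grind,
        fun w x hw hx => ?_⟩
      · simp [flipPath, hpq.symm, hv]
      · simp [hij.symm]
      · have := hw _ _ _ hc
        have := hx _ _ _ hc
        grind
    · have hc' := cycLT_of_not hc hij hjq hpq
      obtain ⟨h', hv⟩ := (path_left_descent π hpq hjq.symm hij).2 ⟨h, hc'⟩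
      have e : flipPath π ((i, j), (i, q)) = ((i, q), (q, j)) := by
        simp [flipPath, hc, hjp, hiq]
      rw [e]
      refine ⟨h', ?_, ?_, (swap_mul_swap_rotate hpq hjq.symm hij).2.1, by grind,
        fun w x hw hx => ?_⟩
      · simp [flipPath, hv]
      · simp [hjq.symm]
      · have := hw _ _ _ hc'
        have := hx _ _ _ hc'
        grind
  by_cases hjq : j = q
  · subst hjq
    by_cases hc : CycLT p i j
    · obtain ⟨h', hv⟩ := (path_left_ascent π (Ne.symm hip) hij hpq).2 ⟨h, hc⟩
      have e : flipPath π ((i, j), (p, j)) = ((p, i), (i, j)) := by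
        simp [flipPath, hc, hjp, hiq, hip]
      rw [e]
      refine ⟨h', ?_, ?_, (swap_mul_swap_rotate (Ne.symm hip) hij hpq).1, by grind,
        fun w x hw hx => ?_⟩
      · simp [flipPath, hv]
      · simp [Ne.symm hip]
      · have := hw _ _ _ hc
        have := hx _ _ _ hc
        grind
    · have hc' : CycLT i p j := by
        unfold CycLT at *
        grind
      obtain ⟨h', hv⟩ := (path_right_descent π hip hpq hij).2 ⟨h, hc'⟩
      have e : flipPath π ((i, j), (p, j)) = ((p, j), (i, p)) := by
        simp [flipPath, hc, hjp, hiq, hip]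
      rw [e]
      refine ⟨h', ?_, ?_, (swap_mul_swap_rotate hip hpq hij).2.2.2, by grind,
        fun w x hw hx => ?_⟩
      · simp [flipPath, hij.symm, hv]
      · simp [Ne.symm hip]
      · have := hw _ _ _ hc'
        have := hx _ _ _ hc'
        grind
  have e : flipPath π ((i, j), (p, q)) = ((p, q), (i, j)) := by
    simp [flipPath, hjp, hiq, hip, hjq]
  rw [e]
  refine ⟨h.swap_of_disjoint hip hiq hjp hjq, ?_, ?_, ?_, by grind, fun w x hw hx => by ring⟩
  · simp [flipPath, Ne.symm hiq, Ne.symm hjp, Ne.symm hip, Ne.symm hjq]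
  · simp [Ne.symm hip]
  · ext x
    simp only [Perm.mul_apply, swap_apply_def]
    grind

open Classical in
/-- The weighted sum of `F` over the covers of `π` that exchange elements of `S`. -/
noncomputable def coverSum (S : Finset α) (w : α → α → ℤ) (F : Perm α → ℤ) (π : Perm α) : ℤ :=
  ∑ p ∈ S ×ˢ S with CycCover π p.1 p.2, w p.1 p.2 * F (π * swap p.1 p.2)

open Classical in
lemma coverSum_coverSum (S : Finset α) (w x : α → α → ℤ) (F : Perm α → ℤ) (π : Perm α) :
    coverSum S w (coverSum S x F) π =
      ∑ r ∈ (S ×ˢ S) ×ˢ (S ×ˢ S) with CycPath π r.1.1 r.1.2 r.2.1 r.2.2,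
        w r.1.1 r.1.2 * x r.2.1 r.2.2 * F (π * (swap r.1.1 r.1.2 * swap r.2.1 r.2.2)) := by
  rw [Finset.sum_filter, Finset.sum_product, coverSum, Finset.sum_filter]
  refine Finset.sum_congr rfl fun r _ => ?_
  by_cases h : CycCover π r.1 r.2
  · simp [h, CycPath, coverSum, Finset.mul_sum, Finset.sum_filter, mul_assoc]
  · simp [h, CycPath]

/-- Weighted cover operators of cocycles commute. -/
theorem coverSum_comm (S : Finset α) {w x : α → α → ℤ} (hw : IsCycCocycle w)
    (hx : IsCycCocycle x) (F : Perm α → ℤ) (π : Perm α) :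
    coverSum S w (coverSum S x F) π = coverSum S x (coverSum S w F) π := by
  classical
  rw [← sub_eq_zero, coverSum_coverSum, coverSum_coverSum, ← Finset.sum_sub_distrib]
  refine Finset.sum_involution (fun r _ => flipPath π r) ?_ ?_ ?_ ?_
  · intro r hr
    have h := CycPath.isFlip (Finset.mem_filter.1 hr).2
    rw [h.target, ← sub_mul, ← sub_mul, h.alternating w x hw hx]
    ring
  · intro r hr _
    exact (CycPath.isFlip (Finset.mem_filter.1 hr).2).ne
  · intro r hr
    simp only [Finset.mem_filter, Finset.mem_product] at hr ⊢
    have h := CycPath.isFlip hr.2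
    obtain ⟨h1, h2, h3, h4⟩ := h.mem S hr.1.1.1 hr.1.1.2 hr.1.2.1 hr.1.2.2
    exact ⟨⟨⟨h1, h2⟩, h3, h4⟩, h.path⟩
  · intro r hr
    exact (CycPath.isFlip (Finset.mem_filter.1 hr).2).flip_eq

/-- The indicator of `j < i`. -/
def wrap (i j : α) : ℤ := if j < i then 1 else 0

lemma isCycCocycle_wrap : IsCycCocycle (wrap : α → α → ℤ) := by
  intro a b c h
  unfold CycLT at h
  unfold wrap
  grind

lemma isCycCocycle_sub (y : α → ℤ) : IsCycCocycle fun i j => y j - y i :=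
  fun _ _ _ _ => by ring

open Classical in
/-- The number of paths of length `m` from `π` to the identity, weighted by `wrap`. -/
noncomputable def pathCount (S : Finset α) : ℕ → Perm α → ℤ
  | 0 => fun π => if π = 1 then 1 else 0
  | m + 1 => coverSum S wrap (pathCount S m)

lemma CycCover.swap_symm {i j : α} (h : CycCover (swap i j) i j) : CycCover (swap i j) j i :=
  ⟨h.1.symm, by simp, by simp, fun c hc => by
    simp only [swap_apply_left, swap_apply_right]
    rw [swap_apply_of_ne_of_ne] <;> unfold CycLT at * <;> grind⟩

/-- The cover operator of a coboundary annihilates the path counts. -/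
theorem coverSum_sub_pathCount (S : Finset α) (y : α → ℤ) (m : ℕ) (π : Perm α) :
    coverSum S (fun i j => y j - y i) (pathCount S m) π = 0 := by
  classical
  induction m generalizing π with
  | zero =>
    simp only [coverSum, pathCount, mul_ite, mul_one, mul_zero, ← Finset.sum_filter,
      Finset.filter_filter, mul_eq_one_iff_eq_inv, swap_inv]
    refine Finset.sum_involution (fun p _ => p.swap) (fun p _ => by simp) ?_ ?_ fun _ _ => rfl
    · intro p hp _ h
      exact (Finset.mem_filter.1 hp).2.1.1 (congrArg Prod.snd h)
    · intro p hp
      simp only [Finset.mem_filter, Finset.mem_product, Prod.fst_swap, Prod.snd_swap] at hp ⊢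
      obtain ⟨⟨h1, h2⟩, h, rfl⟩ := hp
      exact ⟨⟨h2, h1⟩, h.swap_symm, swap_comm _ _⟩
  | succ m ih =>
    rw [pathCount, coverSum_comm S (isCycCocycle_sub y) isCycCocycle_wrap, funext ih]
    simp [coverSum]

/-- `σ` is the cycle `1 ↦ 2 ↦ ⋯ ↦ n ↦ 1`. -/
structure IsRotation (σ : Perm ℕ+) (n : ℕ+) : Prop where
  apply_of_lt : ∀ i, i < n → σ i = i + 1
  apply_self : σ n = 1
  apply_of_gt : ∀ i, n < i → σ i = i

namespace IsRotation

variable {σ π : Perm ℕ+} {n : ℕ+}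

lemma apply_eq_ite (hσ : IsRotation σ n) (i : ℕ+) :
    ((σ i : ℕ+) : ℕ) = if (i : ℕ) < n then (i : ℕ) + 1 else if (i : ℕ) = n then 1 else i := by
  have h1 := hσ.apply_of_lt i
  have h2 := hσ.apply_self
  have h3 := hσ.apply_of_gt i
  rcases lt_trichotomy i n with h | rfl | h
  · have : (i : ℕ) < n := h
    simp [h1 h, this]
  · simp [h2]
  · have h' : (n : ℕ) < i := h
    rw [h3 h, if_neg h'.le.not_gt, if_neg h'.ne']

lemma apply_le_iff (hσ : IsRotation σ n) (i : ℕ+) : σ i ≤ n ↔ i ≤ n := by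
  have := hσ.apply_eq_ite i
  have := n.pos
  rw [← PNat.coe_le_coe, ← PNat.coe_le_coe]
  grind

lemma cycLT_iff (hσ : IsRotation σ n) {a b c : ℕ+} (ha : a ≤ n) (hb : b ≤ n) (hc : c ≤ n) :
    CycLT (σ a) (σ b) (σ c) ↔ CycLT a b c := by
  have h1 := hσ.apply_eq_ite a
  have h2 := hσ.apply_eq_ite b
  have h3 := hσ.apply_eq_ite c
  have := a.pos
  have := b.pos
  have := c.pos
  simp only [CycLT, ← PNat.coe_lt_coe, ← PNat.coe_le_coe] at *
  split_ifs at * <;> omega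

lemma wrap_apply (hσ : IsRotation σ n) {i j : ℕ+} (hi : i ≤ n) (hj : j ≤ n) (hij : i ≠ j) :
    wrap (σ i) (σ j) =
      wrap i j + ((if j = n then 1 else 0) - (if i = n then 1 else 0)) := by
  have h1 := hσ.apply_eq_ite i
  have h2 := hσ.apply_eq_ite j
  have := i.pos
  have := j.pos
  have hij' : (i : ℕ) ≠ j := fun h => hij (PNat.eq h)
  simp only [wrap, ← PNat.coe_lt_coe, ← PNat.coe_le_coe, ← PNat.coe_inj] at *
  split_ifs at * <;> omega

lemma apply_le_of_fix (hπ : ∀ i, n < i → π i = i) {i : ℕ+} (hi : i ≤ n) : π i ≤ n := by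
  by_contra! h
  exact absurd (π.injective (hπ _ h) ▸ h) hi.not_gt

lemma cycCover_conj (hσ : IsRotation σ n) (hπ : ∀ i, n < i → π i = i) {i j : ℕ+}
    (hi : i ≤ n) (hj : j ≤ n) :
    CycCover (σ * π * σ⁻¹) (σ i) (σ j) ↔ CycCover π i j := by
  have hπi := apply_le_of_fix hπ hi
  have hπj := apply_le_of_fix hπ hj
  unfold CycCover
  rw [σ.surjective.forall (p := fun c => CycLT (σ i) c (σ j) →
    ¬ CycLT ((σ * π * σ⁻¹) (σ i)) ((σ * π * σ⁻¹) c) ((σ * π * σ⁻¹) (σ j)))]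
  simp only [Perm.mul_apply, Perm.inv_def, symm_apply_apply, σ.injective.eq_iff, ne_eq,
    hσ.cycLT_iff hi hj hπi, hσ.cycLT_iff hπi hπj hi]
  refine and_congr_right fun h1 => and_congr_right fun h2 => and_congr_right fun h3 =>
    forall_congr' fun c => ?_
  rcases le_or_gt c n with hc | hc
  · rw [hσ.cycLT_iff hi hc hj, hσ.cycLT_iff hπi (apply_le_of_fix hπ hc) hπj]
  · rw [hπ c hc, hσ.apply_of_gt c hc]
    have h4 := (hσ.cycLT_iff hi hj hπi)
    have h5 := (hσ.cycLT_iff hπi hπj hi)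
    have h6 := (hσ.apply_le_iff _).2 hi
    have h7 := (hσ.apply_le_iff _).2 hj
    have h8 := (hσ.apply_le_iff _).2 hπi
    have h9 := (hσ.apply_le_iff _).2 hπj
    have h10 := σ.injective.ne h1
    have h11 := π.injective.ne h1
    have h2' := h2.imp (congrArg σ) h4.2
    have h3' := h3.imp (congrArg σ) h5.2
    have key : ∀ {a b p q : ℕ+}, a ≤ n → b ≤ n → p ≤ n → q ≤ n → a ≠ b →
      (b = p ∨ CycLT a b p) → (q = a ∨ CycLT p q a) → CycLT a c b → ¬ CycLT p c q := by
      clear * - hc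
      intro a b p q
      simp only [CycLT, ← PNat.coe_lt_coe, ← PNat.coe_le_coe, ← PNat.coe_inj, ne_eq] at *
      intros
      omega
    exact iff_of_true (key h6 h7 h8 h9 h10 h2' h3') (key hi hj hπi hπj h1 h2 h3)

/-- Path counts are invariant under rotation. -/
theorem pathCount_conj (hσ : IsRotation σ n) (m : ℕ) (hπ : ∀ i, n < i → π i = i) :
    pathCount (Finset.Icc 1 n) m (σ * π * σ⁻¹) = pathCount (Finset.Icc 1 n) m π := by
  classical
  induction m generalizing π with
  | zero => simp [pathCount, mul_inv_eq_one]
  | succ m ih =>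
    have h0 := coverSum_sub_pathCount (Finset.Icc 1 n) (fun i => if i = n then 1 else 0) m π
    rw [pathCount, ← add_zero (coverSum _ _ _ π), ← h0, coverSum, coverSum, coverSum,
      ← Finset.sum_add_distrib]
    symm
    refine Finset.sum_equiv (σ.prodCongr σ) ?_ ?_
    · rintro ⟨i, j⟩
      simp only [Finset.mem_filter, Finset.mem_product, Finset.mem_Icc, one_le, true_and,
        prodCongr_apply, Prod.map_fst, Prod.map_snd, hσ.apply_le_iff]
      exact and_congr_right fun h => (hσ.cycCover_conj hπ h.1 h.2).symm
    · rintro ⟨i, j⟩ h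
      simp only [Finset.mem_filter, Finset.mem_product, Finset.mem_Icc, one_le, true_and,
        prodCongr_apply, Prod.map_fst, Prod.map_snd] at h ⊢
      obtain ⟨⟨hi, hj⟩, h⟩ := h
      have e : σ * π * σ⁻¹ * swap (σ i) (σ j) = σ * (π * swap i j) * σ⁻¹ := by
        rw [swap_apply_apply]
        group
      have hfix : ∀ c, n < c → (π * swap i j) c = c := fun c hc => by
        rw [Perm.mul_apply, swap_apply_of_ne_of_ne (hi.trans_lt hc).ne' (hj.trans_lt hc).ne',
          hπ c hc]
      rw [e, ih hfix, hσ.wrap_apply hi hj h.1, add_mul]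

end IsRotation

lemma finSupp.exists_fix {u : Perm ℕ+} (hu : finSupp u) : ∃ N, ∀ i, N < i → u i = i := by
  obtain ⟨N, hN⟩ := Set.Finite.bddAbove hu
  exact ⟨N, fun i hi => by_contra fun h => (hN h).not_gt hi⟩

lemma finSupp.mul_swap {u : Perm ℕ+} (hu : finSupp u) (a b : ℕ+) : finSupp (u * swap a b) := by
  refine (Set.Finite.union hu (Set.toFinite {a, b})).subset fun i hi => ?_
  by_contra h
  simp only [Set.mem_union, Set.mem_ofPred_eq, Set.mem_insert_iff, Set.mem_singleton_iff,
    not_or, not_not] at h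
  exact hi (by rw [Perm.mul_apply, swap_apply_of_ne_of_ne h.2.1 h.2.2, h.1])

lemma finSupp.finite_inversions {u : Perm ℕ+} (hu : finSupp u) :
    {p : ℕ+ × ℕ+ | p.1 < p.2 ∧ u p.2 < u p.1}.Finite := by
  obtain ⟨N, hN⟩ := hu.exists_fix
  refine ((Set.finite_Iic N).prod (Set.finite_Iic N)).subset ?_
  rintro ⟨p, q⟩ ⟨h1, h2⟩
  dsimp only at h1 h2
  suffices hq : q ≤ N from ⟨h1.le.trans hq, hq⟩
  by_contra! hq
  rw [hN q hq] at h2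
  have hp : N < u p := hq.trans h2
  rw [u.injective (hN _ hp)] at h2
  exact h1.not_gt h2

/-- Apply `swap a b` to both entries of a pair, unless this destroys their order. -/
def swapPair (a b : ℕ+) (p : ℕ+ × ℕ+) : ℕ+ × ℕ+ :=
  if swap a b p.1 < swap a b p.2 then (swap a b p.1, swap a b p.2) else p

lemma swapPair_swapPair {a b : ℕ+} {p : ℕ+ × ℕ+} (hp : p.1 < p.2) :
    swapPair a b (swapPair a b p) = p := by
  unfold swapPair
  split_ifs with h1 h2
  · simp
  · simp_all
  · rfl

lemma swapPair_mem {u : Perm ℕ+} {a b : ℕ+} (hab : a < b) (h : u a < u b) {p : ℕ+ × ℕ+}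
    (hp : p.1 < p.2 ∧ u p.2 < u p.1) :
    ((swapPair a b p).1 < (swapPair a b p).2 ∧
      (u * swap a b) (swapPair a b p).2 < (u * swap a b) (swapPair a b p).1) ∧
      swapPair a b p ≠ (a, b) := by
  obtain ⟨p, q⟩ := p
  dsimp only at hp
  simp only [swapPair, mul_swap_apply_eq_ite, swap_apply_def]
  grind

lemma swapPair_mem_of_not_between {u : Perm ℕ+} {a b : ℕ+} (hab : a < b)
    (hc : ∀ c, a < c → c < b → ¬ (u a < u c ∧ u c < u b)) {p : ℕ+ × ℕ+}
    (hp : p.1 < p.2 ∧ (u * swap a b) p.2 < (u * swap a b) p.1) (hne : p ≠ (a, b)) :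
    (swapPair a b p).1 < (swapPair a b p).2 ∧
      u (swapPair a b p).2 < u (swapPair a b p).1 := by
  obtain ⟨p, q⟩ := p
  have key (x) := And.intro (hc x) (And.intro (eq_or_lt_or_gt_and_apply u x a)
    (eq_or_lt_or_gt_and_apply u x b))
  have kp := key p
  have kq := key q
  clear hc key
  simp only [swapPair, mul_swap_apply_eq_ite, swap_apply_def] at *
  grind

lemma len_mul_swap_of_lt {u : Perm ℕ+} (hu : finSupp u) {a b : ℕ+} (hab : a < b)
    (h : u a < u b) :
    len u + 1 ≤ len (u * swap a b) ∧ (len (u * swap a b) = len u + 1 ↔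
      ∀ c, a < c → c < b → ¬ (u a < u c ∧ u c < u b)) := by
  unfold len
  set A := {p : ℕ+ × ℕ+ | p.1 < p.2 ∧ u p.2 < u p.1}
  set B := {p : ℕ+ × ℕ+ | p.1 < p.2 ∧ (u * swap a b) p.2 < (u * swap a b) p.1} with hBdef
  have hB : B.Finite := (hu.mul_swap a b).finite_inversions
  have hmem : (a, b) ∈ B := ⟨hab, by simpa using h⟩
  have hcard := Set.ncard_sdiff_singleton_add_one hmem hB
  have himage : (swapPair a b '' A).ncard = A.ncard :=
    Set.InjOn.ncard_image fun p hp q hq e => by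
      rw [← swapPair_swapPair hp.1, e, swapPair_swapPair hq.1]
  have hsub : swapPair a b '' A ⊆ B \ {(a, b)} := by
    rintro _ ⟨p, hp, rfl⟩
    exact swapPair_mem hab h hp
  have hle := Set.ncard_le_ncard hsub hB.sdiff
  refine ⟨by omega, fun e c hac hcb hc => ?_, fun hc => ?_⟩
  · have heq := Set.eq_of_subset_of_ncard_le hsub (by omega) hB.sdiff
    have hmem' : (a, c) ∈ B \ {(a, b)} := by
      refine ⟨⟨hac, ?_⟩, by simp [hcb.ne]⟩
      simpa [swap_apply_of_ne_of_ne hac.ne' hcb.ne] using hc.2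
    rw [← heq] at hmem'
    obtain ⟨p, hp, e⟩ := hmem'
    have hp' := congrArg (swapPair a b) e
    rw [swapPair_swapPair hp.1, swapPair, if_neg] at hp'
    · subst hp'
      exact hc.1.not_gt hp.2
    · simp [swap_apply_of_ne_of_ne hac.ne' hcb.ne, hcb.le]
  · have : swapPair a b '' A = B \ {(a, b)} := hsub.antisymm fun p hp =>
      ⟨swapPair a b p, swapPair_mem_of_not_between hab hc hp.1 hp.2, swapPair_swapPair hp.1.1⟩
    rw [← this] at hcard
    omega

lemma len_mul_swap_eq_iff {u : Perm ℕ+} (hu : finSupp u) {a b : ℕ+} (hab : a < b) :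
    len (u * swap a b) = len u + 1 ↔
      u a < u b ∧ ∀ c, a < c → c < b → ¬ (u a < u c ∧ u c < u b) := by
  rcases lt_or_gt_of_ne (u.injective.ne hab.ne) with h | h
  · rw [(len_mul_swap_of_lt hu hab h).2, and_iff_right h]
  · have := (len_mul_swap_of_lt (hu.mul_swap a b) hab (by simpa using h)).1
    rw [mul_assoc, swap_mul_self, mul_one] at this
    exact iff_of_false (by omega) fun h' => h.not_gt h'.1

/-- A necessary condition for `u ≤_k w`, local in pairs of positions. -/
structure IsBelow (k : ℕ) (u w : Perm ℕ+) : Prop where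
  le : ∀ a : ℕ+, (a : ℕ) ≤ k → u a ≤ w a
  ge : ∀ b : ℕ+, k < (b : ℕ) → w b ≤ u b
  left : ∀ c d : ℕ+, c < d → (d : ℕ) ≤ k → u c < u d → w c < w d
  right : ∀ c d : ℕ+, k < (c : ℕ) → c < d → u c < u d → w c < w d

lemma IsBelow.refl (k : ℕ) (w : Perm ℕ+) : IsBelow k w w :=
  ⟨fun _ _ => le_rfl, fun _ _ => le_rfl, fun _ _ _ _ h => h, fun _ _ _ _ h => h⟩

lemma lt_of_le_of_lt_coe {k : ℕ} {a b : ℕ+} (ha : (a : ℕ) ≤ k) (hb : k < (b : ℕ)) : a < b :=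
  PNat.coe_lt_coe _ _ |>.1 (ha.trans_lt hb)

lemma kBruhatCover_mul_swap_iff {k : ℕ} {u : Perm ℕ+} (hu : finSupp u) {v : Perm ℕ+} :
    kBruhatCover k u v ↔ ∃ a b : ℕ+, ((a : ℕ) ≤ k ∧ k < (b : ℕ) ∧ u a < u b ∧
      ∀ c, a < c → c < b → ¬ (u a < u c ∧ u c < u b)) ∧ v = u * swap a b := by
  refine exists_congr fun a => exists_congr fun b => ?_
  constructor
  · rintro ⟨ha, hb, rfl, h⟩
    exact ⟨⟨ha, hb, (len_mul_swap_eq_iff hu (lt_of_le_of_lt_coe ha hb)).1 h⟩, rfl⟩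
  · rintro ⟨⟨ha, hb, h⟩, rfl⟩
    exact ⟨ha, hb, rfl, (len_mul_swap_eq_iff hu (lt_of_le_of_lt_coe ha hb)).2 h⟩

lemma finSupp.of_kBruhatCover {k : ℕ} {u v : Perm ℕ+} (hu : finSupp u)
    (h : kBruhatCover k u v) : finSupp v := by
  obtain ⟨a, b, -, -, rfl, -⟩ := h
  exact hu.mul_swap a b

lemma IsBelow.of_mul_swap {k : ℕ} {u w : Perm ℕ+} {a b : ℕ+} (ha : (a : ℕ) ≤ k)
    (hb : k < (b : ℕ)) (hab : u a < u b) (hc : ∀ c, a < c → c < b → ¬ (u a < u c ∧ u c < u b))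
    (h : IsBelow k (u * swap a b) w) : IsBelow k u w := by
  have hlt := lt_of_le_of_lt_coe ha hb
  refine ⟨fun x hx => ?_, fun x hx => ?_, fun x y hxy hy => ?_, fun x y hx hxy => ?_⟩
  · have h1 := h.le x hx
    have hxb := (lt_of_le_of_lt_coe hx hb).ne
    clear hc h
    rw [mul_swap_apply_eq_ite] at h1
    grind
  · have h1 := h.ge x hx
    have hxa := (lt_of_le_of_lt_coe ha hx).ne'
    clear hc h
    rw [mul_swap_apply_eq_ite] at h1
    grind
  · have h1 := h.left x y hxy hy
    have hyb := lt_of_le_of_lt_coe hy hb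
    have hy' := hc y
    have ky := eq_or_lt_or_gt_and_apply u y b
    clear hc h
    rw [mul_swap_apply_eq_ite, mul_swap_apply_eq_ite] at h1
    grind
  · have h1 := h.right x y hx hxy
    have hxa := lt_of_le_of_lt_coe ha hx
    have hx' := hc x
    have kx := eq_or_lt_or_gt_and_apply u x a
    clear hc h
    rw [mul_swap_apply_eq_ite, mul_swap_apply_eq_ite] at h1
    grind

lemma IsBelow.of_kBruhatLE {k : ℕ} {u w : Perm ℕ+} (hu : finSupp u) (h : kBruhatLE k u w) :
    IsBelow k u w := by
  induction h using Relation.ReflTransGen.head_induction_on with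
  | refl => exact .refl k w
  | head h _ ih =>
    have := ih (hu.of_kBruhatCover h)
    obtain ⟨a, b, ⟨ha, hb, hab, hc⟩, rfl⟩ := (kBruhatCover_mul_swap_iff hu).1 h
    exact this.of_mul_swap ha hb hab hc

lemma IsBelow.cycCover_of_mul_swap {k : ℕ} {u w : Perm ℕ+} {a b : ℕ+} (h : IsBelow k u w)
    (ha : (a : ℕ) ≤ k) (hb : k < (b : ℕ)) (hab : u a < u b)
    (hc : ∀ c, a < c → c < b → ¬ (u a < u c ∧ u c < u b)) (h' : IsBelow k (u * swap a b) w) :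
    CycCover (u * w⁻¹) (w a) (w b) ∧ w b < w a := by
  have e1 : u b ≤ w a := by simpa using h'.le a ha
  have e2 : w b ≤ u a := by simpa using h'.ge b hb
  have hba : w b < w a := e2.trans_lt (hab.trans_le e1)
  have hlt := lt_of_le_of_lt_coe ha hb
  refine ⟨⟨hba.ne', ?_, ?_, ?_⟩, hba⟩
  · simp only [Perm.mul_apply, Perm.inv_def, symm_apply_apply, CycLT]
    clear hc
    grind
  · simp only [Perm.mul_apply, Perm.inv_def, symm_apply_apply, CycLT]
    clear hc
    grind
  · rw [w.surjective.forall]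
    intro e
    simp only [Perm.mul_apply, Perm.inv_def, symm_apply_apply, CycLT]
    have h5 := hc e
    have h6 := eq_or_lt_or_gt_and_apply w e a
    have h7 := eq_or_lt_or_gt_and_apply w e b
    rcases le_or_gt (e : ℕ) k with he | he
    · have h1 := h.le e he
      have h2 := lt_of_le_of_lt_coe he hb
      have h3 := h'.left e a
      rw [mul_swap_apply_eq_ite, mul_swap_apply_eq_ite] at h3
      clear hc h h'
      grind
    · have h1 := h.ge e he
      have h2 := lt_of_le_of_lt_coe ha he
      have h3 := h'.right b e hb
      rw [mul_swap_apply_eq_ite, mul_swap_apply_eq_ite] at h3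
      clear hc h h'
      grind

lemma IsBelow.mul_swap_of_cycCover {k : ℕ} {u w : Perm ℕ+} {a b : ℕ+} (h : IsBelow k u w)
    (hc : CycCover (u * w⁻¹) (w a) (w b)) (hba : w b < w a) :
    ((a : ℕ) ≤ k ∧ k < (b : ℕ) ∧ u a < u b ∧ ∀ c, a < c → c < b → ¬ (u a < u c ∧ u c < u b)) ∧
      IsBelow k (u * swap a b) w := by
  obtain ⟨-, e1, e2, hc⟩ := hc
  rw [w.surjective.forall] at hc
  simp only [Perm.mul_apply, Perm.inv_def, symm_apply_apply, CycLT] at e1 e2 hc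
  have e3 : u a < u b ∧ u b ≤ w a ∧ w b ≤ u a := by
    clear hc h
    grind
  obtain ⟨hab, e4, e5⟩ := e3
  have ha : (a : ℕ) ≤ k := by
    by_contra! ha
    exact absurd (h.ge a ha) (hab.trans_le e4).not_ge
  have hb : k < (b : ℕ) := by
    by_contra! hb
    exact absurd (h.le b hb) (e5.trans_lt hab).not_ge
  have hlt := lt_of_le_of_lt_coe ha hb
  replace hc : ∀ c, (w c < w b ∨ w a < w c) → ¬ (u a < u c ∧ u c < u b) := by
    intro c
    specialize hc c
    clear h
    grind
  clear e1 e2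
  refine ⟨⟨ha, hb, hab, fun c hac hcb => ?_⟩, fun x hx => ?_, fun x hx => ?_,
    fun x y hxy hy => ?_, fun x y hx hxy => ?_⟩
  · have h1 := h.left a c hac
    have h2 := fun h' => h.right c b h' hcb
    have h3 := hc c
    have h4 := le_or_gt (c : ℕ) k
    clear hc h
    grind
  · have h1 := h.le x hx
    have hxb := lt_of_le_of_lt_coe hx hb
    rw [mul_swap_apply_eq_ite]
    clear hc h
    grind
  · have h1 := h.ge x hx
    have hxa := lt_of_le_of_lt_coe ha hx
    rw [mul_swap_apply_eq_ite]
    clear hc h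
    grind
  · have h1 := h.left x y hxy hy
    have hyb := lt_of_le_of_lt_coe hy hb
    have kx := eq_or_lt_or_gt_and_apply w x a
    have kx' := eq_or_lt_or_gt_and_apply u x a
    have hx := hc x
    rw [mul_swap_apply_eq_ite, mul_swap_apply_eq_ite]
    clear hc h
    grind
  · have h1 := h.right x y hx hxy
    have hxa := lt_of_le_of_lt_coe ha hx
    have ky := eq_or_lt_or_gt_and_apply w y b
    have ky' := eq_or_lt_or_gt_and_apply u y b
    have hy := hc y
    rw [mul_swap_apply_eq_ite, mul_swap_apply_eq_ite]
    clear hc h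
    grind

lemma CycCover.le_of_lt {π : Perm ℕ+} {n i j : ℕ+} (hπ : ∀ i, n < i → π i = i)
    (h : CycCover π i j) (hji : j < i) : i ≤ n := by
  by_contra! hi
  have h1 := h.2.1
  rw [hπ i hi] at h1
  unfold CycLT at h1
  grind

lemma swap_eq_swap_iff_of_lt {a b c d : α} (hba : b < a) (hdc : d < c) :
    swap a b = swap c d ↔ (a, b) = (c, d) := by
  refine ⟨fun h => ?_, fun h => by cases h; rfl⟩
  have h1 := congrFun (congrArg DFunLike.coe h) a
  have h2 := congrFun (congrArg DFunLike.coe h) c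
  simp only [swap_apply_def] at h1 h2
  grind

lemma mem_chainsSet {k : ℕ} {u w : Perm ℕ+} {c : List (Perm ℕ+)} :
    c ∈ chainsSet k u w ↔
      List.IsChain (kBruhatCover k) c ∧ c.head? = some u ∧ c.getLast? = some w :=
  Iff.rfl

lemma mem_chainsSet_cons_iff {k : ℕ} {u w : Perm ℕ+} {c : List (Perm ℕ+)} (hc : c ≠ []) :
    u :: c ∈ chainsSet k u w ↔ ∃ v, kBruhatCover k u v ∧ c ∈ chainsSet k v w := by
  obtain ⟨v, c, rfl⟩ := List.exists_cons_of_ne_nil hc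
  simp only [mem_chainsSet, List.isChain_cons_cons, List.head?_cons,
    List.getLast?_cons_cons, Option.some.injEq]
  grind

lemma kBruhatLE_of_mem_chainsSet {k : ℕ} {u w : Perm ℕ+} {c : List (Perm ℕ+)}
    (hc : c ∈ chainsSet k u w) : kBruhatLE k u w := by
  obtain ⟨h1, h2, h3⟩ := hc
  obtain ⟨c, rfl⟩ := List.head?_eq_some_iff.1 h2
  refine List.relationReflTransGen_of_exists_isChain_cons c h1 ?_
  simpa [List.getLast?_eq_some_getLast] using h3

/-- The chains of length `m` from `u` to `w` are counted by `pathCount`. -/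
theorem exists_finset_chains {k : ℕ} {n : ℕ+} {w : Perm ℕ+} (m : ℕ) {u : Perm ℕ+}
    (hu : finSupp u) (hfix : ∀ i, n < i → (u * w⁻¹) i = i) (h : IsBelow k u w) :
    ∃ T : Finset (List (Perm ℕ+)), (∀ c, c ∈ T ↔ c ∈ chainsSet k u w ∧ c.length = m + 1) ∧
      (T.card : ℤ) = pathCount (Finset.Icc 1 n) m (u * w⁻¹) := by
  classical
  induction m generalizing u with
  | zero =>
    refine ⟨if u = w then {[u]} else ∅, fun c => ?_, ?_⟩
    · simp only [zero_add, List.length_eq_one_iff]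
      constructor
      · intro hc
        split_ifs at hc with huw
        · rw [Finset.mem_singleton.1 hc]
          simp [mem_chainsSet, huw]
        · simp at hc
      · rintro ⟨⟨-, h2, h3⟩, v, rfl⟩
        simp_all
    · simp only [pathCount, mul_inv_eq_one]
      split_ifs <;> simp
  | succ m ih =>
    set P := {p ∈ Finset.Icc 1 n ×ˢ Finset.Icc 1 n | CycCover (u * w⁻¹) p.1 p.2 ∧ p.2 < p.1}
      with hP
    let v : ℕ+ × ℕ+ → Perm ℕ+ := fun p => u * swap (w⁻¹ p.1) (w⁻¹ p.2)
    have hv (p) : v p * w⁻¹ = u * w⁻¹ * swap p.1 p.2 := by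
      simp only [v]
      rw [swap_apply_apply]
      group
    have hstep (p) (hp : p ∈ P) := h.mul_swap_of_cycCover (a := w⁻¹ p.1) (b := w⁻¹ p.2)
      (by simpa using (Finset.mem_filter.1 hp).2.1) (by simpa using (Finset.mem_filter.1 hp).2.2)
    have hT (p) (hp : p ∈ P) := ih (hu.mul_swap (w⁻¹ p.1) (w⁻¹ p.2)) (fun i hi => by
      simp only [hP, Finset.mem_filter, Finset.mem_product, Finset.mem_Icc] at hp
      have := hv p
      simp only [v] at this
      rw [this, Perm.mul_apply, swap_apply_of_ne_of_ne (hp.1.1.2.trans_lt hi).ne'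
        (hp.1.2.2.trans_lt hi).ne', hfix i hi]) (hstep p hp).2
    choose! T hT hcard using hT
    refine ⟨P.biUnion fun p => (T p).image (u :: ·), fun c => ?_, ?_⟩
    · simp only [Finset.mem_biUnion, Finset.mem_image]
      constructor
      · rintro ⟨p, hp, c, hc, rfl⟩
        obtain ⟨h1, h2⟩ := (hT p hp c).1 hc
        refine ⟨(mem_chainsSet_cons_iff (by rintro rfl; simp at h2)).2 ⟨_, ?_, h1⟩, by simp [h2]⟩
        exact (kBruhatCover_mul_swap_iff hu).2 ⟨_, _, (hstep p hp).1, rfl⟩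
      · rintro ⟨hc, hlen⟩
        obtain ⟨c, rfl⟩ := List.head?_eq_some_iff.1 hc.2.1
        rw [List.length_cons, add_left_inj] at hlen
        obtain ⟨v', h1, h2⟩ := (mem_chainsSet_cons_iff (by rintro rfl; simp at hlen)).1 hc
        have h3 := IsBelow.of_kBruhatLE (hu.of_kBruhatCover h1) (kBruhatLE_of_mem_chainsSet h2)
        obtain ⟨a, b, ⟨ha, hb, hab, hbtw⟩, rfl⟩ := (kBruhatCover_mul_swap_iff hu).1 h1
        obtain ⟨h4, h5⟩ := h.cycCover_of_mul_swap ha hb hab hbtw h3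
        have hp : (w a, w b) ∈ P := by
          have := h4.le_of_lt hfix h5
          simp [hP, h4, h5, this, h5.le.trans this]
        exact ⟨(w a, w b), hp, c, (hT _ hp c).2 ⟨by simpa using h2, hlen⟩, rfl⟩
    · rw [Finset.card_biUnion, pathCount, coverSum]
      · push_cast
        simp only [wrap, ite_mul, one_mul, zero_mul, ← Finset.sum_filter, Finset.filter_filter]
        refine Finset.sum_congr rfl fun p hp => ?_
        rw [Finset.card_image_of_injective _ (List.cons_injective), hcard p hp, ← hv]
      · intro p hp q hq hpq
        rw [Function.onFun, Finset.disjoint_left]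
        simp only [Finset.mem_image, not_exists, not_and]
        rintro _ ⟨c, hc, rfl⟩ c' hc' e
        obtain rfl := List.cons_injective e
        have e1 := ((hT p hp _).1 hc).1.2.1
        have e2 := ((hT q hq _).1 hc').1.2.1
        have e3 : v p = v q := Option.some.inj (e1.symm.trans e2)
        have e4 := (hv p).symm.trans ((congrArg (· * w⁻¹) e3).trans (hv q))
        exact hpq ((swap_eq_swap_iff_of_lt (Finset.mem_filter.1 hp).2.2
          (Finset.mem_filter.1 hq).2.2).1 (mul_left_cancel e4))

lemma ncard_eq_of_fibers {β : Type*} {A B : Set β} (f : β → ℕ)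
    (h : ∀ m, ∃ S T : Finset β, (∀ c, c ∈ S ↔ c ∈ A ∧ f c = m) ∧ (∀ c, c ∈ T ↔ c ∈ B ∧ f c = m) ∧
      S.card = T.card) : A.ncard = B.ncard := by
  choose S T hS hT hST using h
  have e (A : Set β) (S : ℕ → Finset β) (hS : ∀ m c, c ∈ S m ↔ c ∈ A ∧ f c = m) (m : ℕ) :
      {c : A // f c = m} ≃ S m :=
    (subtypeSubtypeEquivSubtypeInter (· ∈ A) (f · = m)).trans
      (subtypeEquivRight fun c => (hS m c).symm)
  exact Nat.card_congr ((sigmaFiberEquiv fun c : A => f c).symm.trans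
    ((sigmaCongrRight fun m => (e A S hS m).trans ((Finset.equivOfCardEq (hST m)).trans
      (e B T hT m).symm)).trans (sigmaFiberEquiv fun c : B => f c)))

end

/-- Corollary 1.3.6 (cyclic shift): if `z∘x⁻¹` is the conjugate of `w∘u⁻¹ ∈ S_n`
by the `n`-cycle `σ = (1 2 … n)`, then `[u,w]_k` and `[x,z]_k` have the same
number of saturated chains. -/
theorem stmt19 (n : ℕ+) (k : ℕ) (hk : 0 < k)
    (u w x z σ : Equiv.Perm ℕ+)
    (hu : finSupp u) (hw : finSupp w) (hx : finSupp x) (hz : finSupp z)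
    (hσ1 : ∀ i : ℕ+, i < n → σ i = i + 1) (hσ2 : σ n = 1)
    (hσ3 : ∀ i : ℕ+, n < i → σ i = i)
    (hwu : ∀ i : ℕ+, n < i → (w * u⁻¹) i = i)
    (hzx : ∀ i : ℕ+, n < i → (z * x⁻¹) i = i)
    (huw : kBruhatLE k u w) (hxz : kBruhatLE k x z)
    (hconj : z * x⁻¹ = σ * (w * u⁻¹) * σ⁻¹) :
    (chainsSet k u w).ncard = (chainsSet k x z).ncard := by
  have hinv (u w : Equiv.Perm ℕ+) (h : ∀ i, n < i → (w * u⁻¹) i = i) (i : ℕ+) (hi : n < i) :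
      (u * w⁻¹) i = i := by
    rw [← inv_inv (u * w⁻¹), mul_inv_rev, inv_inv, Equiv.Perm.inv_eq_iff_eq, h i hi]
  refine ncard_eq_of_fibers List.length fun m => ?_
  cases m with
  | zero =>
    have hne (u w : Equiv.Perm ℕ+) (c) (hc : c ∈ chainsSet k u w) : c ≠ [] := by
      rintro rfl
      simp [mem_chainsSet] at hc
    refine ⟨∅, ∅, fun c => ?_, fun c => ?_, rfl⟩ <;> simpa using hne _ _ c
  | succ m =>
    obtain ⟨S, hS, hS'⟩ := exists_finset_chains m hu (hinv u w hwu) (.of_kBruhatLE hu huw)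
    obtain ⟨T, hT, hT'⟩ := exists_finset_chains m hx (hinv x z hzx) (.of_kBruhatLE hx hxz)
    refine ⟨S, T, hS, hT, ?_⟩
    have e : x * z⁻¹ = σ * (u * w⁻¹) * σ⁻¹ := by
      rw [← inv_inv (x * z⁻¹), mul_inv_rev, inv_inv, hconj]
      group
    rw [e, IsRotation.pathCount_conj ⟨hσ1, hσ2, hσ3⟩ m (hinv u w hwu), ← hS'] at hT'
    exact_mod_cast hT'.symm
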